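/- Hopf Lemma (Lemma 3.2). Let U ⊆ ℝⁿ (n ≥ 1) be a bounded open set and let (u₁, u₂) be a viscosity supersolution of the system −Δ∞u₁ + u₁ − u₂ = 0, −Δ∞u₂ + u₂ − u₁ = 0 in U. Let V be an open set with closure contained in U, and let x₀ ∈ ∂V be such that u₁(x₀) ≤ u_i(x) for all i ∈ {1,2} and all x ∈ U, and u₁(x₀) < u_i(x) for all i ∈ {1,2} and all x ∈ V. Assume the interior ball condition at x₀: there exist z ∈ V and R > 0 with the open ball B(z,R) ⊆ V and |x₀ − z| = R. Then liminf_{s→0⁺} (u₁(x₀ − sν) − u₁(x₀))/s > 0, where ν := (x₀ − z)/R. -/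

import Mathlib

open Filter Metric Set Topology

noncomputable def secondDeriv {n : ℕ} (φ : EuclideanSpace ℝ (Fin n) → ℝ)
    (x v : EuclideanSpace ℝ (Fin n)) : ℝ :=
  iteratedFDeriv ℝ 2 φ x ![v, v]

open scoped Classical in
noncomputable def laplInfPlus {n : ℕ} (φ : EuclideanSpace ℝ (Fin n) → ℝ)
    (x : EuclideanSpace ℝ (Fin n)) : ℝ :=
  if gradient φ x = 0 then
    sSup {t : ℝ | ∃ v : EuclideanSpace ℝ (Fin n), ‖v‖ = 1 ∧ t = secondDeriv φ x v}
  else secondDeriv φ x (gradient φ x) / ‖gradient φ x‖ ^ 2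

open scoped Classical in
noncomputable def laplInfMinus {n : ℕ} (φ : EuclideanSpace ℝ (Fin n) → ℝ)
    (x : EuclideanSpace ℝ (Fin n)) : ℝ :=
  if gradient φ x = 0 then
    sInf {t : ℝ | ∃ v : EuclideanSpace ℝ (Fin n), ‖v‖ = 1 ∧ t = secondDeriv φ x v}
  else secondDeriv φ x (gradient φ x) / ‖gradient φ x‖ ^ 2

/-- One half of the subsolution condition: `-Δ∞⁺φ(x₀) + u(x₀) - v(x₀) ≤ 0` at
local maximum points of `u - φ`. -/
def SubPair {n : ℕ} (U : Set (EuclideanSpace ℝ (Fin n)))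
    (u v : EuclideanSpace ℝ (Fin n) → ℝ) : Prop :=
  ∀ φ : EuclideanSpace ℝ (Fin n) → ℝ, ContDiff ℝ 2 φ →
    ∀ x₀ ∈ U, IsLocalMaxOn (fun x => u x - φ x) U x₀ →
      -laplInfPlus φ x₀ + u x₀ - v x₀ ≤ 0

def SuperPair {n : ℕ} (U : Set (EuclideanSpace ℝ (Fin n)))
    (u v : EuclideanSpace ℝ (Fin n) → ℝ) : Prop :=
  ∀ φ : EuclideanSpace ℝ (Fin n) → ℝ, ContDiff ℝ 2 φ →
    ∀ x₀ ∈ U, IsLocalMinOn (fun x => u x - φ x) U x₀ →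
      0 ≤ -laplInfMinus φ x₀ + u x₀ - v x₀

/-- `(u₁, u₂)` is a viscosity subsolution of the system
`-Δ∞u₁ + u₁ - u₂ = 0`, `-Δ∞u₂ + u₂ - u₁ = 0` in `U`. -/
def IsSubsolution {n : ℕ} (U : Set (EuclideanSpace ℝ (Fin n)))
    (u₁ u₂ : EuclideanSpace ℝ (Fin n) → ℝ) : Prop :=
  UpperSemicontinuousOn u₁ U ∧ UpperSemicontinuousOn u₂ U ∧
    SubPair U u₁ u₂ ∧ SubPair U u₂ u₁

/-- `(u₁, u₂)` is a viscosity supersolution of the system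
`-Δ∞u₁ + u₁ - u₂ = 0`, `-Δ∞u₂ + u₂ - u₁ = 0` in `U`. -/
def IsSupersolution {n : ℕ} (U : Set (EuclideanSpace ℝ (Fin n)))
    (u₁ u₂ : EuclideanSpace ℝ (Fin n) → ℝ) : Prop :=
  LowerSemicontinuousOn u₁ U ∧ LowerSemicontinuousOn u₂ U ∧
    SuperPair U u₁ u₂ ∧ SuperPair U u₂ u₁

def IsSolution {n : ℕ} (U : Set (EuclideanSpace ℝ (Fin n)))
    (u₁ u₂ : EuclideanSpace ℝ (Fin n) → ℝ) : Prop :=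
  IsSubsolution U u₁ u₂ ∧ IsSupersolution U u₁ u₂

/-- First component of the generalized cone pair with vertex `x₀`. -/
noncomputable def cone₁ {n : ℕ} (x₀ : EuclideanSpace ℝ (Fin n)) (C₁ C₂ a b : ℝ)
    (x : EuclideanSpace ℝ (Fin n)) : ℝ :=
  C₁ * Real.exp (Real.sqrt 2 * ‖x - x₀‖) + C₂ * Real.exp (-(Real.sqrt 2 * ‖x - x₀‖)) +
    a * ‖x - x₀‖ + b

/-- Second component of the generalized cone pair with vertex `x₀`. -/
noncomputable def cone₂ {n : ℕ} (x₀ : EuclideanSpace ℝ (Fin n)) (C₁ C₂ a b : ℝ)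
    (x : EuclideanSpace ℝ (Fin n)) : ℝ :=
  -C₁ * Real.exp (Real.sqrt 2 * ‖x - x₀‖) - C₂ * Real.exp (-(Real.sqrt 2 * ‖x - x₀‖)) +
    a * ‖x - x₀‖ + b

noncomputable def sphMax {n : ℕ} (u : EuclideanSpace ℝ (Fin n) → ℝ)
    (x₀ : EuclideanSpace ℝ (Fin n)) (r : ℝ) : ℝ :=
  sSup (u '' sphere x₀ r)

noncomputable def sphMin {n : ℕ} (u : EuclideanSpace ℝ (Fin n) → ℝ)
    (x₀ : EuclideanSpace ℝ (Fin n)) (r : ℝ) : ℝ :=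
  sInf (u '' sphere x₀ r)

noncomputable def Splus {n : ℕ} (u : EuclideanSpace ℝ (Fin n) → ℝ)
    (x₀ : EuclideanSpace ℝ (Fin n)) (r : ℝ) : ℝ :=
  (sphMax u x₀ r - u x₀) / r

noncomputable def Sminus {n : ℕ} (u : EuclideanSpace ℝ (Fin n) → ℝ)
    (x₀ : EuclideanSpace ℝ (Fin n)) (r : ℝ) : ℝ :=
  (sphMin u x₀ r - u x₀) / r


/-- The radial polynomial `ε (σ² - ρ² σ)` with `σ = ‖x - c‖² - ρ²`, which vanishes on the sphere of
radius `ρ` about `c` and is a strict subsolution of the infinity Laplace equation near it. -/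
noncomputable def radialBarrier {n : ℕ} (ε ρ : ℝ) (c x : EuclideanSpace ℝ (Fin n)) : ℝ :=
  ε * ((‖x - c‖ ^ 2 - ρ ^ 2) ^ 2 - ρ ^ 2 * (‖x - c‖ ^ 2 - ρ ^ 2))

section RadialBarrier

variable {n : ℕ} (ε ρ : ℝ) (c : EuclideanSpace ℝ (Fin n))

theorem contDiff_radialBarrier : ContDiff ℝ 2 (radialBarrier ε ρ c) := by
  have h : ContDiff ℝ 2 fun x : EuclideanSpace ℝ (Fin n) => ‖x - c‖ ^ 2 :=
    (contDiff_id.sub contDiff_const).norm_sq ℝ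
  unfold radialBarrier
  fun_prop

theorem hasFDerivAt_norm_sub_sq (x : EuclideanSpace ℝ (Fin n)) :
    HasFDerivAt (fun x => ‖x - c‖ ^ 2) ((2 : ℝ) • innerSL ℝ (x - c)) x := by
  refine ((hasFDerivAt_id x).sub_const c).norm_sq.congr_fderiv (ContinuousLinearMap.ext fun v => ?_)
  simp

theorem hasFDerivAt_radialBarrier (x : EuclideanSpace ℝ (Fin n)) :
    HasFDerivAt (radialBarrier ε ρ c)
      ((2 * ε * (2 * ‖x - c‖ ^ 2 - 3 * ρ ^ 2)) • innerSL ℝ (x - c)) x := by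
  have h := (hasFDerivAt_norm_sub_sq c x).sub_const (ρ ^ 2)
  refine (((h.pow 2).sub (h.const_mul (ρ ^ 2))).const_mul ε).congr_fderiv
    (ContinuousLinearMap.ext fun v => ?_)
  simp
  ring

theorem gradient_radialBarrier (x : EuclideanSpace ℝ (Fin n)) :
    gradient (radialBarrier ε ρ c) x =
      (2 * ε * (2 * ‖x - c‖ ^ 2 - 3 * ρ ^ 2)) • (x - c) := by
  apply HasGradientAt.gradient
  rw [hasGradientAt_iff_hasFDerivAt]
  refine (hasFDerivAt_radialBarrier ε ρ c x).congr_fderiv (ContinuousLinearMap.ext fun v => ?_)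
  simp

theorem secondDeriv_radialBarrier (x v : EuclideanSpace ℝ (Fin n)) :
    secondDeriv (radialBarrier ε ρ c) x v =
      2 * ε * (2 * ‖x - c‖ ^ 2 - 3 * ρ ^ 2) * ‖v‖ ^ 2 + 8 * ε * inner ℝ (x - c) v ^ 2 := by
  have h1 : fderiv ℝ (radialBarrier ε ρ c) =
      fun y => (2 * ε * (2 * ‖y - c‖ ^ 2 - 3 * ρ ^ 2)) • innerSL ℝ (y - c) :=
    funext fun y => (hasFDerivAt_radialBarrier ε ρ c y).fderiv
  have h2 : HasFDerivAt (fun y : EuclideanSpace ℝ (Fin n) => innerSL ℝ (y - c))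
      (innerSL ℝ) x :=
    (innerSL ℝ (E := EuclideanSpace ℝ (Fin n))).hasFDerivAt.comp x
      ((hasFDerivAt_id x).sub_const c)
  have h3 := ((((hasFDerivAt_norm_sub_sq c x).const_mul 2).sub_const (3 * ρ ^ 2)).const_mul
    (2 * ε)).fun_smul h2
  rw [secondDeriv, iteratedFDeriv_two_apply, h1, h3.fderiv]
  change 2 * ε * (2 * ‖x - c‖ ^ 2 - 3 * ρ ^ 2) * inner ℝ v v +
    2 * ε * (2 * (2 * inner ℝ (x - c) v)) * inner ℝ (x - c) v = _
  rw [real_inner_self_eq_norm_sq]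
  ring

theorem laplInfMinus_radialBarrier_pos {ε ρ : ℝ} (hε : 0 < ε) {c x : EuclideanSpace ℝ (Fin n)}
    (h : |‖x - c‖ ^ 2 - ρ ^ 2| < ρ ^ 2 / 2) :
    0 < laplInfMinus (radialBarrier ε ρ c) x := by
  obtain ⟨h1, h2⟩ := abs_lt.1 h
  have hk : 2 * ε * (2 * ‖x - c‖ ^ 2 - 3 * ρ ^ 2) < 0 :=
    mul_neg_of_pos_of_neg (by linarith) (by linarith)
  have hx : x - c ≠ 0 := by
    intro h0
    rw [h0, norm_zero] at h1
    nlinarith [sq_nonneg ρ]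
  have hg : gradient (radialBarrier ε ρ c) x ≠ 0 := by
    rw [gradient_radialBarrier]
    exact smul_ne_zero hk.ne hx
  rw [laplInfMinus, if_neg hg]
  refine div_pos ?_ (by positivity)
  have hn : 0 < ‖x - c‖ ^ 2 := by positivity
  rw [secondDeriv_radialBarrier, gradient_radialBarrier, norm_smul, real_inner_smul_right,
    real_inner_self_eq_norm_sq, mul_pow, Real.norm_eq_abs, sq_abs]
  generalize ‖x - c‖ ^ 2 = q at *
  have hp : 0 < (2 * ε * (2 * q - 3 * ρ ^ 2)) ^ 2 * q * ε * (12 * q - 6 * ρ ^ 2) := by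
    have := sq_pos_of_neg hk
    have : 0 < 12 * q - 6 * ρ ^ 2 := by linarith
    positivity
  linarith

end RadialBarrier

theorem SuperPair.lt_of_isLocalMinOn {n : ℕ} {U : Set (EuclideanSpace ℝ (Fin n))}
    {u v φ : EuclideanSpace ℝ (Fin n) → ℝ} (h : SuperPair U u v) (hφ : ContDiff ℝ 2 φ)
    {x : EuclideanSpace ℝ (Fin n)} (hx : x ∈ U)
    (hmin : IsLocalMinOn (fun y => u y - φ y) U x) (hpos : 0 < laplInfMinus φ x) :
    v x < u x := by
  have := h φ hφ x hx hmin
  linarith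

theorem LowerSemicontinuousOn.exists_pos_forall_add_le {α : Type*} [TopologicalSpace α]
    {u : α → ℝ} {K : Set α} (hK : IsCompact K) (hu : LowerSemicontinuousOn u K) {m : ℝ}
    (hm : ∀ x ∈ K, m < u x) : ∃ δ > 0, ∀ x ∈ K, m + δ ≤ u x := by
  rcases K.eq_empty_or_nonempty with rfl | hne
  · exact ⟨1, one_pos, by simp⟩
  · obtain ⟨y, hy, hmin⟩ := hu.exists_isMinOn hne hK
    exact ⟨u y - m, sub_pos.2 (hm y hy), fun x hx => by simpa using hmin hx⟩

/-- A supersolution cannot attain its minimum over both components at an interior point which is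
touched by a closed ball on the rest of which both components are strictly larger. -/
theorem IsSupersolution.false_of_min_at_touching_ball {n : ℕ}
    {U : Set (EuclideanSpace ℝ (Fin n))} (hU : IsOpen U) {u₁ u₂ : EuclideanSpace ℝ (Fin n) → ℝ}
    (hsup : IsSupersolution U u₁ u₂) {x₀ c : EuclideanSpace ℝ (Fin n)} {ρ : ℝ} (hρ : 0 < ρ)
    (hx₀ : x₀ ∈ U) (hc : ‖x₀ - c‖ = ρ)
    (hmin : ∀ x ∈ U, u₁ x₀ ≤ u₁ x ∧ u₁ x₀ ≤ u₂ x)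
    (hstrict : ∀ x ∈ closedBall c ρ, x ≠ x₀ → u₁ x₀ < u₁ x ∧ u₁ x₀ < u₂ x) : False := by
  obtain ⟨hl₁, hl₂, hs₁, hs₂⟩ := hsup
  have hev : ∀ᶠ x in 𝓝 x₀, x ∈ U ∧ |‖x - c‖ ^ 2 - ρ ^ 2| < ρ ^ 2 / 2 := by
    refine Filter.Eventually.and (hU.mem_nhds hx₀) ?_
    have hcont : Continuous fun x : EuclideanSpace ℝ (Fin n) => |‖x - c‖ ^ 2 - ρ ^ 2| := by
      fun_prop
    refine hcont.continuousAt.eventually_lt continuousAt_const ?_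
    simp only [hc, sub_self, abs_zero]
    positivity
  obtain ⟨r, hr, hD⟩ := nhds_basis_closedBall.eventually_iff.1 hev
  have hDU : closedBall x₀ r ⊆ U := fun x hx => (hD hx).1
  have hK : IsCompact (sphere x₀ r ∩ closedBall c ρ) :=
    (isCompact_sphere x₀ r).inter_right isClosed_closedBall
  have hKU : sphere x₀ r ∩ closedBall c ρ ⊆ U :=
    fun x hx => hDU (sphere_subset_closedBall hx.1)
  have hne : ∀ x ∈ sphere x₀ r, x ≠ x₀ := fun x hx => ne_of_mem_sphere hx hr.ne'
  obtain ⟨δ₁, hδ₁, hb₁⟩ := (hl₁.mono hKU).exists_pos_forall_add_le hK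
    fun x hx => (hstrict x hx.2 (hne x hx.1)).1
  obtain ⟨δ₂, hδ₂, hb₂⟩ := (hl₂.mono hKU).exists_pos_forall_add_le hK
    fun x hx => (hstrict x hx.2 (hne x hx.1)).2
  set δ := min δ₁ δ₂
  have hδ : 0 < δ := lt_min hδ₁ hδ₂
  set ε := δ / ρ ^ 4
  have hε : 0 < ε := by positivity
  have hερ : ε * ρ ^ 4 = δ := div_mul_cancel₀ _ (by positivity)
  set w := radialBarrier ε ρ c
  have hw0 : w x₀ = 0 := by simp [w, radialBarrier, hc]
  have hwc : ContDiff ℝ 2 w := contDiff_radialBarrier ε ρ c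
  have hsphere : ∀ u : EuclideanSpace ℝ (Fin n) → ℝ, (∀ x ∈ U, u₁ x₀ ≤ u x) →
      (∀ x ∈ sphere x₀ r ∩ closedBall c ρ, u₁ x₀ + δ ≤ u x) →
      ∀ x ∈ sphere x₀ r, u₁ x₀ < u x - w x := by
    intro u hu hb x hx
    obtain ⟨hxU, hxs⟩ := hD (sphere_subset_closedBall hx)
    obtain ⟨h1, h2⟩ := abs_lt.1 hxs
    have hwx : w x = ε * ((‖x - c‖ ^ 2 - ρ ^ 2) ^ 2 - ρ ^ 2 * (‖x - c‖ ^ 2 - ρ ^ 2)) := rfl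
    have hρ2 : 0 < ρ ^ 2 := by positivity
    by_cases hxc : x ∈ closedBall c ρ
    · have hlt : (‖x - c‖ ^ 2 - ρ ^ 2) ^ 2 - ρ ^ 2 * (‖x - c‖ ^ 2 - ρ ^ 2) < ρ ^ 4 := by
        nlinarith
      have := mul_lt_mul_of_pos_left hlt hε
      linarith [hb x ⟨hx, hxc⟩]
    · rw [mem_closedBall, dist_eq_norm, not_le] at hxc
      have hpos : 0 < ‖x - c‖ ^ 2 - ρ ^ 2 := by nlinarith
      have : w x < 0 := by
        rw [hwx]
        exact mul_neg_of_pos_of_neg hε (by nlinarith)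
      linarith [hu x hxU]
  have hmem : x₀ ∈ closedBall x₀ r := mem_closedBall_self hr.le
  have hargmin : ∀ u : EuclideanSpace ℝ (Fin n) → ℝ, LowerSemicontinuousOn u U →
      ∃ x ∈ closedBall x₀ r, IsMinOn (fun y => u y - w y) (closedBall x₀ r) x := by
    intro u hu
    have hlsc : LowerSemicontinuousOn (fun y => u y - w y) (closedBall x₀ r) := by
      simp only [sub_eq_add_neg]
      exact (hu.mono hDU).add (hwc.continuous.neg.lowerSemicontinuous.lowerSemicontinuousOn _)
    exact hlsc.exists_isMinOn ⟨x₀, hmem⟩ (isCompact_closedBall x₀ r)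
  have hinterior : ∀ u v : EuclideanSpace ℝ (Fin n) → ℝ, SuperPair U u v →
      (∀ x ∈ sphere x₀ r, u₁ x₀ < u x - w x) → ∀ x ∈ closedBall x₀ r,
      IsMinOn (fun y => u y - w y) (closedBall x₀ r) x → u x - w x ≤ u₁ x₀ → v x < u x := by
    intro u v hs hb x hx hxmin hle
    have hxb : x ∈ ball x₀ r := by
      rw [← closedBall_sdiff_sphere]
      exact ⟨hx, fun hxs => (hb x hxs).not_ge hle⟩
    exact hs.lt_of_isLocalMinOn hwc (hDU hx)
      ((hxmin.isLocalMin (closedBall_mem_nhds_of_mem hxb)).on U)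
      (laplInfMinus_radialBarrier_pos hε (hD hx).2)
  obtain ⟨x₁, hx₁, hm₁⟩ := hargmin u₁ hl₁
  obtain ⟨x₂, hx₂, hm₂⟩ := hargmin u₂ hl₂
  have h₁₀ : u₁ x₁ - w x₁ ≤ u₁ x₀ - w x₀ := hm₁ hmem
  have h₂₁ : u₂ x₂ - w x₂ ≤ u₂ x₁ - w x₁ := hm₂ hx₁
  have h₁₂ : u₁ x₁ - w x₁ ≤ u₁ x₂ - w x₂ := hm₁ hx₂
  have hb₁' := hsphere u₁ (fun x hx => (hmin x hx).1)
    fun x hx => (add_le_add_right (min_le_left δ₁ δ₂) _).trans (hb₁ x hx)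
  have hb₂' := hsphere u₂ (fun x hx => (hmin x hx).2)
    fun x hx => (add_le_add_right (min_le_right δ₁ δ₂) _).trans (hb₂ x hx)
  rcases le_total (u₁ x₁ - w x₁) (u₂ x₂ - w x₂) with hle | hle
  · have := hinterior u₁ u₂ hs₁ hb₁' x₁ hx₁ hm₁ (by linarith)
    linarith
  · have := hinterior u₂ u₁ hs₂ hb₂' x₂ hx₂ hm₂ (by linarith)
    linarith

/-- The closed ball with half the radius, internally tangent at `x`, lies in the open ball except
for the point of tangency. -/
theorem mem_ball_of_mem_closedBall_midpoint {E : Type*} [NormedAddCommGroup E]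
    [InnerProductSpace ℝ E] {x y z : E} {R : ℝ} (hxz : ‖x - z‖ = R)
    (hy : y ∈ closedBall (midpoint ℝ x z) (R / 2)) (hne : y ≠ x) : y ∈ ball z R := by
  have hR : 0 ≤ R := hxz ▸ norm_nonneg _
  rw [mem_closedBall, dist_eq_norm] at hy
  rw [mem_ball, dist_eq_norm]
  have h1 := parallelogram_law_with_norm ℝ (y - x) (y - z)
  have h2 : (y - x) + (y - z) = (2 : ℝ) • (y - midpoint ℝ x z) := by
    rw [midpoint_eq_smul_add, smul_sub, smul_smul, mul_invOf_self]
    module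
  have h3 : (y - x) - (y - z) = -(x - z) := by abel
  rw [h2, h3, norm_smul, norm_neg, hxz, Real.norm_two] at h1
  have h4 : 0 < ‖y - x‖ := norm_pos_iff.2 (sub_ne_zero.2 hne)
  have h5 := norm_nonneg (y - midpoint ℝ x z)
  nlinarith [norm_nonneg (y - z)]

/-- Hopf Lemma (Lemma 3.2). -/
theorem hopf_lemma {n : ℕ} (hn : 1 ≤ n)
    {U : Set (EuclideanSpace ℝ (Fin n))} (hUo : IsOpen U) (hUb : Bornology.IsBounded U)
    {u₁ u₂ : EuclideanSpace ℝ (Fin n) → ℝ}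
    (hsup : IsSupersolution U u₁ u₂)
    {V : Set (EuclideanSpace ℝ (Fin n))} (hVo : IsOpen V) (hVU : closure V ⊆ U)
    {x₀ : EuclideanSpace ℝ (Fin n)} (hx₀ : x₀ ∈ frontier V)
    (hmin : ∀ x ∈ U, u₁ x₀ ≤ u₁ x ∧ u₁ x₀ ≤ u₂ x)
    (hstrict : ∀ x ∈ V, u₁ x₀ < u₁ x ∧ u₁ x₀ < u₂ x)
    {z : EuclideanSpace ℝ (Fin n)} {R : ℝ} (hR : 0 < R) (hz : z ∈ V)
    (hball : ball z R ⊆ V) (hxz : ‖x₀ - z‖ = R) :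
    0 < liminf (fun s : ℝ =>
      (u₁ (x₀ - s • (R⁻¹ • (x₀ - z))) - u₁ x₀) / s) (𝓝[>] (0:ℝ)) := by
  have hxV : ∀ x ∈ closedBall (midpoint ℝ x₀ z) (R / 2), x ≠ x₀ → x ∈ V :=
    fun x hx hne => hball (mem_ball_of_mem_closedBall_midpoint hxz hx hne)
  have hmid : ‖x₀ - midpoint ℝ x₀ z‖ = R / 2 := by
    rw [← dist_eq_norm, dist_left_midpoint, dist_eq_norm, hxz, Real.norm_two]
    ring
  exact (hsup.false_of_min_at_touching_ball hUo (half_pos hR) (hVU hx₀.1) hmid hmin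
    fun x hx hne => hstrict x (hxV x hx hne)).elim
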